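/- Let k be a field of characteristic ≠ 2 such that I(k)² = 0, where I(k) is the fundamental ideal of the Witt ring W(k) (equivalently: any two quadratic spaces over k of the same dimension and the same determinant in k*/k*² are isometric). Let M be a semi-simple module and let q be a quadratic space over k with dim(q) = dim_k(M). Then q has an isometry with module M if and only if det(q)·F_M(1)·F_M(−1) is a square in k (possibly 0). -/

import Mathlib

open Polynomial

noncomputable section

variable {k : Type} [Field k]

/-- `f*(X) = f(0)⁻¹ X^{deg f} f(1/X)`. -/
def starPoly (f : k[X]) : k[X] := Polynomial.C (f.coeff 0)⁻¹ * f.reverse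

/-- Type 0 : a product of powers of `X - 1` and `X + 1`. -/
def IsType0Pol (f : k[X]) : Prop := ∃ a b : ℕ, f = (X - 1 : k[X]) ^ a * (X + 1) ^ b

/-- Type 1 : a product of (powers of) monic symmetric irreducible polynomials of even degree. -/
def IsType1Pol (f : k[X]) : Prop :=
  ∃ s : Multiset k[X],
    (∀ g ∈ s, g.Monic ∧ Irreducible g ∧ g = g.reverse ∧ Even g.natDegree) ∧ f = s.prod

/-- Type 2 : a product of polynomials `g * g*` with `g` monic irreducible, `g ≠ ±g*`. -/
def IsType2Pol (f : k[X]) : Prop :=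
  ∃ s : Multiset k[X],
    (∀ g ∈ s, g.Monic ∧ Irreducible g ∧ g ≠ starPoly g ∧ g ≠ -starPoly g) ∧
    f = (s.map fun g => g * starPoly g).prod

/-- A monic polynomial is hyperbolic if it is of the form `G·G*`; equivalently, all its
components of type 0 and 1 occur with an even exponent. -/
def IsHyperbolicPoly (f : k[X]) : Prop := ∃ g : k[X], g.Monic ∧ f = g * starPoly g

/-- Data describing a self-dual torsion `k[X]`-module which is finite dimensional over `k`:
the direct sum, over `i`, of `[k[X]/(f i ^ e i)]^(n i)`, where each `f i` is monic
irreducible, and where the collection is self-dual (stable under `f ↦ f*`). -/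
structure ModuleData (k : Type) [Field k] where
  ι : Type
  [fin : Fintype ι]
  f : ι → k[X]
  e : ι → ℕ
  n : ι → ℕ
  monic : ∀ i, (f i).Monic
  irr : ∀ i, Irreducible (f i)
  epos : ∀ i, 0 < e i
  npos : ∀ i, 0 < n i
  selfdual : ∃ σ : Equiv.Perm ι,
    ∀ i, f (σ i) = starPoly (f i) ∧ e (σ i) = e i ∧ n (σ i) = n i

attribute [instance] ModuleData.fin

namespace ModuleData

variable (D : ModuleData k)

/-- The underlying `K[X]`-module of `M ⊗_k K`, realised concretely, for an extension
`ι : k →+* K`. -/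
abbrev SpaceVia {K : Type} [Field K] (ι : k →+* K) : Type :=
  (i : D.ι) → Fin (D.n i) →
    (Polynomial K ⧸ Ideal.span {((D.f i).map ι) ^ D.e i})

/-- The dimension of `M` as a `k`-vector space. -/
def dim : ℕ := ∑ i, D.n i * (D.e i * (D.f i).natDegree)

/-- The characteristic polynomial `F_M` of `M`. -/
def charPoly : k[X] := ∏ i, D.f i ^ (D.n i * D.e i)

/-- The summand `i` is of type 0 : `f i` is `X - 1` or `X + 1`. -/
def IsIdx0 (i : D.ι) : Prop := D.f i = X - 1 ∨ D.f i = X + 1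

/-- The summand `i` is of type 1 : `f i` is symmetric of even degree. -/
def IsIdx1 (i : D.ι) : Prop := D.f i = (D.f i).reverse ∧ Even (D.f i).natDegree

/-- The summand `i` is of type 2 : `f i` is not self-dual. -/
def IsIdx2 (i : D.ι) : Prop := D.f i ≠ starPoly (D.f i)

open Classical in
/-- `dim_k M⁰`. -/
def dim0 : ℕ := ∑ i, if D.IsIdx0 i then D.n i * (D.e i * (D.f i).natDegree) else 0

open Classical in
/-- `dim_k M¹`. -/
def dim1 : ℕ := ∑ i, if D.IsIdx1 i then D.n i * (D.e i * (D.f i).natDegree) else 0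

open Classical in
/-- `dim_k M²`. -/
def dim2 : ℕ := ∑ i, if D.IsIdx2 i then D.n i * (D.e i * (D.f i).natDegree) else 0

/-- `M` is semi-simple : all exponents are 1. -/
def Semisimple : Prop := ∀ i, D.e i = 1

/-- `M̄_odd` : the direct sum of the summands `[k[X]/(f)]^n`, over those summands
`[k[X]/(f^e)]^n` of `M` with `e` odd and `f` self-dual (`f = f*`). -/
def oddBar : ModuleData k where
  ι := {i : D.ι // Odd (D.e i) ∧ D.f i = starPoly (D.f i)}
  fin := by classical exact inferInstance
  f i := D.f i.1
  e _ := 1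
  n i := D.n i.1
  monic i := D.monic i.1
  irr i := D.irr i.1
  epos _ := one_pos
  npos i := D.npos i.1
  selfdual := ⟨Equiv.refl _, fun i => ⟨i.2.2, rfl, rfl⟩⟩

end ModuleData

theorem starPoly_eq_self_of_symm {f : k[X]} (hm : f.Monic) (hs : f = f.reverse) :
    starPoly f = f := by
  have h0 : f.coeff 0 = 1 := by
    conv_lhs => rw [hs]
    rw [Polynomial.coeff_zero_reverse]
    exact hm
  rw [starPoly, h0, inv_one, map_one, one_mul, ← hs]

/-- The module `[k[X]/(f)]^m` for a monic symmetric irreducible `f`. -/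
def ModuleData.single (f : k[X]) (hmon : f.Monic) (hirr : Irreducible f)
    (hsym : f = f.reverse) (m : ℕ) (hm : 0 < m) : ModuleData k where
  ι := Unit
  fin := inferInstance
  f _ := f
  e _ := 1
  n _ := m
  monic _ := hmon
  irr _ := hirr
  epos _ := one_pos
  npos _ := hm
  selfdual := ⟨Equiv.refl _, fun _ => ⟨(starPoly_eq_self_of_symm hmon hsym).symm, rfl, rfl⟩⟩

section Bilin

variable {V : Type} [AddCommGroup V] [Module k V]

/-- `t` is an isometry of the bilinear space `(V, B)`. -/
def IsIsometryOf (B : LinearMap.BilinForm k V) (t : V ≃ₗ[k] V) : Prop :=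
  ∀ x y, B (t x) (t y) = B x y

/-- `(V, B)` is a quadratic space : `B` is a symmetric bilinear form of non-zero
determinant (equivalently, non-degenerate). -/
def IsQuadraticSpace (B : LinearMap.BilinForm k V) : Prop :=
  (∀ x y, B x y = B y x) ∧ (∀ x, (∀ y, B x y = 0) → x = 0)

/-- The bilinear space `(W, B)` over an extension `ι : k →+* K` has an isometry whose
associated `K[X]`-module is `M ⊗_k K`. -/
def HasIsometryWithModuleVia {K : Type} [Field K] (ι : k →+* K)
    {W : Type} [AddCommGroup W] [Module K W]
    (B : LinearMap.BilinForm K W) (D : ModuleData k) : Prop :=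
  ∃ t : W ≃ₗ[K] W, IsIsometryOf B t ∧
    ∃ φ : W ≃ₗ[K] D.SpaceVia ι, ∀ w, φ (t w) = (X : Polynomial K) • φ w

/-- `(V, B)` has an isometry with module `M`. -/
def HasIsometryWithModule (B : LinearMap.BilinForm k V) (D : ModuleData k) : Prop :=
  HasIsometryWithModuleVia (RingHom.id k) B D

/-- The bilinear space `(W, B)` over an extension `ι : k →+* K` has an isometry with
minimal polynomial (the image of) `f`. -/
def HasIsometryWithMinpolyVia {K : Type} [Field K] (ι : k →+* K)
    {W : Type} [AddCommGroup W] [Module K W]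
    (B : LinearMap.BilinForm K W) (f : k[X]) : Prop :=
  ∃ t : W ≃ₗ[K] W, IsIsometryOf B t ∧ minpoly K t.toLinearMap = f.map ι

/-- `(V, B)` has an isometry with minimal polynomial `f`. -/
def HasIsometryWithMinpoly (B : LinearMap.BilinForm k V) (f : k[X]) : Prop :=
  ∃ t : V ≃ₗ[k] V, IsIsometryOf B t ∧ minpoly k t.toLinearMap = f

/-- A (2n)-dimensional quadratic space is hyperbolic if it has a self-orthogonal subspace
of dimension n. -/
def IsHyperbolicSpace (B : LinearMap.BilinForm k V) : Prop :=
  ∃ W : Submodule k V, (∀ x ∈ W, ∀ y ∈ W, B x y = 0) ∧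
    2 * Module.finrank k W = Module.finrank k V

/-- The Witt index : the largest dimension of a totally isotropic subspace. -/
def wittIndex (B : LinearMap.BilinForm k V) : ℕ :=
  sSup {m | ∃ W : Submodule k V, (∀ x ∈ W, ∀ y ∈ W, B x y = 0) ∧ Module.finrank k W = m}

variable [FiniteDimensional k V]

/-- The Gram matrix of `B` with respect to a fixed basis. -/
def gramOf (B : LinearMap.BilinForm k V) :
    Matrix (Fin (Module.finrank k V)) (Fin (Module.finrank k V)) k :=
  LinearMap.toMatrix₂ (Module.finBasis k V) (Module.finBasis k V) B

/-- The determinant of `B` (well defined modulo nonzero squares). -/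
def detOf (B : LinearMap.BilinForm k V) : k := (gramOf B).det

end Bilin


section Helpers

theorem Matrix.isSquare_det_of_transpose_eq_neg {K : Type*} [Field K] (h2 : (2 : K) ≠ 0)
    {ι : Type*} [Fintype ι] [DecidableEq ι] (A : Matrix ι ι K) (hA : A.transpose = -A) :
    IsSquare A.det := by
  induction hn : Fintype.card ι using Nat.strong_induction_on generalizing ι with
  | _ n ih =>
  by_cases h0 : A = 0
  · subst h0
    rcases isEmpty_or_nonempty ι with h | h
    · simp
    · simp [Matrix.det_zero]
  have hA' : ∀ i j, A j i = -A i j := fun i j => congrFun (congrFun hA i) j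
  have hd : ∀ i, A i i = 0 := fun i =>
    (mul_eq_zero_iff_left h2).mp (by linear_combination hA' i i)
  obtain ⟨a, b, hab⟩ : ∃ a b, A a b ≠ 0 := by
    by_contra! h
    exact h0 (Matrix.ext h)
  have hne : a ≠ b := fun h => hab (by rw [h, hd])
  let p : ι → Prop := fun i => i = a ∨ i = b
  let P := A.toSquareBlockProp p
  let Q := A.toBlock p (fun i => ¬ p i)
  let R := A.toBlock (fun i => ¬ p i) p
  let S := A.toSquareBlockProp (fun i => ¬ p i)
  have hdet : A.det = (Matrix.fromBlocks P Q R S).det :=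
    (Matrix.det_toBlock A p).trans rfl
  let e : Fin 2 ≃ {i // p i} :=
    { toFun := ![⟨a, Or.inl rfl⟩, ⟨b, Or.inr rfl⟩]
      invFun := fun i => if i.1 = a then 0 else 1
      left_inv := by intro i; fin_cases i <;> simp [hne.symm]
      right_inv := by
        rintro ⟨i, rfl | rfl⟩
        · simp
        · simp [hne.symm] }
  have hP : P.det = A a b * A a b := by
    rw [← Matrix.det_submatrix_equiv_self e P, Matrix.det_fin_two]
    simp [P, e, Matrix.toSquareBlockProp, hd, hA' a b]
  have hPu : IsUnit P.det := by rw [hP]; exact (mul_ne_zero hab hab).isUnit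
  let _ : Invertible P := Matrix.invertibleOfIsUnitDet P hPu
  have hPt : P.transpose = -P := Matrix.ext fun i j => hA' i j
  have hQt : Q.transpose = -R := Matrix.ext fun i j => hA' i j
  have hRt : R.transpose = -Q := Matrix.ext fun i j => hA' i j
  have hSt : S.transpose = -S := Matrix.ext fun i j => hA' i j
  have hPit : (⅟P).transpose = -⅟P := by
    rw [Matrix.invOf_eq_nonsing_inv, Matrix.transpose_nonsing_inv, hPt]
    apply Matrix.inv_eq_left_inv
    rw [neg_mul_neg]
    exact Matrix.nonsing_inv_mul P hPu
  rw [hdet, Matrix.det_fromBlocks₁₁, hP]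
  refine (IsSquare.mul_self _).mul (ih _ ?_ _ ?_ rfl)
  · rw [← hn]
    exact Fintype.card_subtype_lt (x := a) (by simp [p])
  · rw [Matrix.transpose_sub, Matrix.transpose_mul, Matrix.transpose_mul, hPit, hQt, hRt, hSt]
    simp only [Matrix.neg_mul, Matrix.mul_neg, neg_neg, Matrix.mul_assoc]
    abel

theorem IsIsometryOf.isSquare_det_mul {V : Type} [AddCommGroup V] [Module k V]
    (h2 : (2 : k) ≠ 0) {B : LinearMap.BilinForm k V} (hB : ∀ x y, B x y = B y x)
    {t : V ≃ₗ[k] V} (ht : IsIsometryOf B t) {ι : Type*} [Fintype ι] [DecidableEq ι]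
    (b : Module.Basis ι k V) :
    IsSquare ((LinearMap.toMatrix₂ b b B).det *
      (LinearMap.det (algebraMap k (Module.End k V) 1 - t.toLinearMap) *
        LinearMap.det (algebraMap k (Module.End k V) (-1) - t.toLinearMap))) := by
  set G := LinearMap.toMatrix₂ b b B
  set T₁ := algebraMap k (Module.End k V) 1 - t.toLinearMap with hT₁
  set T₂ := algebraMap k (Module.End k V) (-1) - t.toLinearMap with hT₂
  have key : G.det * (T₁.det * T₂.det) = (LinearMap.toMatrix₂ b b (B.compl₁₂ T₁ T₂)).det := by
    rw [LinearMap.toMatrix₂_compl₁₂ b b, Matrix.det_mul, Matrix.det_mul, Matrix.det_transpose,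
      LinearMap.det_toMatrix, LinearMap.det_toMatrix]
    ring
  rw [key]
  refine Matrix.isSquare_det_of_transpose_eq_neg h2 _ (Matrix.ext fun i j => ?_)
  simp only [Matrix.transpose_apply, Matrix.neg_apply, LinearMap.toMatrix₂_apply,
    LinearMap.compl₁₂_apply, hT₁, hT₂, LinearMap.sub_apply, Module.algebraMap_end_apply,
    map_sub, LinearEquiv.coe_coe, one_smul, map_neg, LinearMap.neg_apply]
  rw [ht (b j) (b i), ht (b i) (b j), hB (b j) (b i), hB (t (b j)) (b i), hB (b j) (t (b i))]
  ring

/-- An involution of the index set compatible with an involution of the labels exists as soon as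
a compatible permutation does, and it may be taken to fix the indices with invariant label. -/
theorem Equiv.Perm.exists_involution_of_comp_eq {ι α : Type*} (g : ι → α) (star : α → α)
    (hstar : ∀ i, star (star (g i)) = g i) (σ : Equiv.Perm ι)
    (hσ : ∀ i, g (σ i) = star (g i)) :
    ∃ τ : ι → ι, (∀ i, τ (τ i) = i) ∧ (∀ i, g (τ i) = star (g i)) ∧
      ∀ i, star (g i) = g i → τ i = i := by
  classical
  let _ : LinearOrder α := linearOrderOfSTO WellOrderingRel
  have hσ' : ∀ i, g (σ.symm i) = star (g i) := fun i => by
    conv_rhs => rw [← σ.apply_symm_apply i, hσ, hstar]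
  refine ⟨fun i => if g i < star (g i) then σ i else if star (g i) < g i then σ.symm i else i,
    fun i => ?_, fun i => ?_, fun i h => by simp [h]⟩
  · rcases lt_trichotomy (g i) (star (g i)) with h | h | h
    · simp [h, hσ, hstar, h.not_gt]
    · simp [← h]
    · simp [h, hσ', hstar, h.not_gt]
  · rcases lt_trichotomy (g i) (star (g i)) with h | h | h
    · simp [h, hσ]
    · simp [← h]
    · simp [h, hσ', h.not_gt]

theorem starPoly_starPoly {f : k[X]} (hf : f.Monic) (h0 : f.coeff 0 ≠ 0) :
    starPoly (starPoly f) = f := by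
  have h1 : (starPoly f).coeff 0 = (f.coeff 0)⁻¹ := by
    rw [starPoly, coeff_C_mul, coeff_zero_reverse, hf.leadingCoeff, mul_one]
  have hd : f.reverse.natDegree = f.natDegree := by
    rw [reverse_natDegree, natTrailingDegree_eq_zero.mpr (Or.inr h0), Nat.sub_zero]
  have h2 : (starPoly f).reverse = C (f.coeff 0)⁻¹ * f := by
    rw [starPoly, reverse_mul_of_domain, reverse_C, reverse, hd, reverse, reflect_reflect]
  rw [starPoly, h1, h2, ← mul_assoc, ← C_mul, inv_inv, mul_inv_cancel₀ h0, C_1, one_mul]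

theorem coeff_zero_ne_zero_of_starPoly_monic {f : k[X]} (h : (starPoly f).Monic) :
    f.coeff 0 ≠ 0 := fun h0 => by
  rw [starPoly, h0, inv_zero, C_0, zero_mul] at h
  exact h.ne_zero rfl

/-- The quotient algebra `k[X]/(g)`. -/
abbrev QuotAlg (g : k[X]) : Type := k[X] ⧸ Ideal.span {g}

/-- The class of `X` in `k[X]/(g)`. -/
abbrev quotX (g : k[X]) : QuotAlg g := Ideal.Quotient.mk _ X

theorem QuotAlg.algHom_ext {g : k[X]} {A : Type*} [CommRing A] [Algebra k A]
    {φ ψ : QuotAlg g →ₐ[k] A} (h : φ (quotX g) = ψ (quotX g)) : φ = ψ := by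
  refine Ideal.Quotient.algHom_ext k (Polynomial.algHom_ext ?_)
  simpa using h

theorem QuotAlg.eval_charpoly_lmul {g : k[X]} (hg : g.Monic) (x : k) :
    LinearMap.det (algebraMap k (Module.End k (QuotAlg g)) x -
      LinearMap.mulLeft k (quotX g)) = g.eval x := by
  let pb : PowerBasis k (AdjoinRoot g) := AdjoinRoot.powerBasis' hg
  have : Module.Finite k (AdjoinRoot g) := pb.finite
  have : Module.Free k (AdjoinRoot g) := Module.Free.of_basis pb.basis
  have h := charpoly_leftMulMatrix pb
  rw [Algebra.leftMulMatrix_apply, LinearMap.charpoly_toMatrix, AdjoinRoot.powerBasis'_gen,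
    AdjoinRoot.minpoly_root hg.ne_zero, hg.leadingCoeff, inv_one, C_1, mul_one] at h
  have hx := congrArg (eval x) h
  rw [LinearMap.eval_charpoly] at hx
  exact hx

theorem QuotAlg.finite {g : k[X]} (hg : g.Monic) : Module.Finite k (QuotAlg g) :=
  (AdjoinRoot.powerBasis' hg).finite

theorem QuotAlg.finrank {g : k[X]} (hg : g.Monic) :
    Module.finrank k (QuotAlg g) = g.natDegree :=
  (AdjoinRoot.powerBasis' hg).finrank

theorem QuotAlg.exists_algHom_starPoly {f : k[X]} (hf : Irreducible f) (h0 : f.coeff 0 ≠ 0)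
    {g : k[X]} (hg : g = starPoly f) :
    ∃ θ : QuotAlg g →ₐ[k] QuotAlg f, θ (quotX g) * quotX f = 1 := by
  have : (Ideal.span {f}).IsMaximal := PrincipalIdealRing.isMaximal_of_irreducible hf
  let _ : Field (QuotAlg f) := Ideal.Quotient.field _
  have hX : quotX f ≠ 0 := by
    intro h
    rw [quotX, Ideal.Quotient.eq_zero_iff_mem, Ideal.mem_span_singleton] at h
    have := (hf.associated_of_dvd irreducible_X h).symm.dvd
    exact h0 (X_dvd_iff.mp this)
  let _ : Invertible (quotX f) := invertibleOfNonzero hX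
  have hroot : aeval (⅟(quotX f)) g = 0 := by
    rw [hg, starPoly, map_mul]
    have : aeval (⅟(quotX f)) f.reverse = 0 := by
      rw [aeval_def, eval₂_reverse_eq_zero_iff, ← aeval_def]
      exact AdjoinRoot.eval₂_root f
    rw [this, mul_zero]
  refine ⟨Ideal.Quotient.liftₐ _ (aeval (⅟(quotX f))) fun p hp => ?_, ?_⟩
  · obtain ⟨q, rfl⟩ := Ideal.mem_span_singleton.mp hp
    rw [map_mul, hroot, zero_mul]
  · erw [Ideal.Quotient.liftₐ_apply]
    simp

theorem Matrix.det_blockDiagonal'_eq_prod {R : Type*} [CommRing R] {o : Type*} [Fintype o]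
    [DecidableEq o] {m : o → Type*} [∀ i, Fintype (m i)] [∀ i, DecidableEq (m i)]
    (M : ∀ i, Matrix (m i) (m i) R) : (Matrix.blockDiagonal' M).det = ∏ i, (M i).det := by
  classical
  let _ : LinearOrder o := linearOrderOfSTO WellOrderingRel
  have hM : (Matrix.blockDiagonal' M).BlockTriangular Sigma.fst := fun i j h =>
    Matrix.blockDiagonal'_apply_ne M _ _ h.ne'
  rw [hM.det_fintype]
  refine Finset.prod_congr rfl fun c _ => ?_
  rw [← Matrix.det_submatrix_equiv_self (Equiv.sigmaSubtype c).symm]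
  congr 1
  ext i j
  exact Matrix.blockDiagonal'_apply_eq M c i j

/-- Multiplication by `X` on a product of quotients of `k[X]`. -/
def piMulX {T : Type} (g : T → k[X]) : Module.End k (∀ c, QuotAlg (g c)) :=
  LinearMap.mulLeft k fun c => quotX (g c)

theorem piMulX_apply {T : Type} (g : T → k[X]) (x : ∀ c, QuotAlg (g c)) (c : T) :
    piMulX g x c = quotX (g c) * x c := rfl

theorem det_algebraMap_sub_piMulX {T : Type} [Fintype T] {g : T → k[X]}
    (hg : ∀ c, (g c).Monic) (x : k) :
    LinearMap.det (algebraMap k (Module.End k (∀ c, QuotAlg (g c))) x - piMulX g) =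
      ∏ c, (g c).eval x := by
  classical
  have := fun c => QuotAlg.finite (hg c)
  let b := fun c => Module.finBasis k (QuotAlg (g c))
  rw [← LinearMap.det_toMatrix (Pi.basis b)]
  have : LinearMap.toMatrix (Pi.basis b) (Pi.basis b)
      (algebraMap k (Module.End k (∀ c, QuotAlg (g c))) x - piMulX g) =
      Matrix.blockDiagonal' fun c => LinearMap.toMatrix (b c) (b c)
        (algebraMap k (Module.End k (QuotAlg (g c))) x - LinearMap.mulLeft k (quotX (g c))) := by
    ext ⟨c, i⟩ ⟨d, j⟩
    rw [LinearMap.toMatrix_apply, Pi.basis_repr, Pi.basis_apply]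
    simp only [LinearMap.sub_apply, Module.algebraMap_end_apply, Pi.sub_apply, Pi.smul_apply,
      piMulX_apply]
    by_cases h : c = d
    · subst h
      rw [Matrix.blockDiagonal'_apply_eq, LinearMap.toMatrix_apply, Pi.single_eq_same]
      simp
    · rw [Matrix.blockDiagonal'_apply_ne _ _ _ h, Pi.single_eq_of_ne h]
      simp
  rw [this, Matrix.det_blockDiagonal'_eq_prod]
  exact Finset.prod_congr rfl fun c _ => by
    rw [LinearMap.det_toMatrix, QuotAlg.eval_charpoly_lmul (hg c)]

theorem exists_invariant_form {T : Type} [Fintype T] [DecidableEq T] (h2 : (2 : k) ≠ 0)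
    {g : T → k[X]} (hg : ∀ c, Irreducible (g c)) (h0 : ∀ c, (g c).coeff 0 ≠ 0)
    {τ : T → T} (hτ : ∀ c, τ (τ c) = c) (hgτ : ∀ c, g (τ c) = starPoly (g c)) :
    ∃ B : LinearMap.BilinForm k (∀ c, QuotAlg (g c)), IsQuadraticSpace B ∧
      (∀ x y, B (piMulX g x) (piMulX g y) = B x y) ∧
      ∀ c, τ c = c → B (Pi.single c 1) (Pi.single c 1) ≠ 0 := by
  have hmax := fun c => PrincipalIdealRing.isMaximal_of_irreducible (hg c)
  let _ : ∀ c, Field (QuotAlg (g c)) := fun c => Ideal.Quotient.field _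
  choose θ hθ using fun c => QuotAlg.exists_algHom_starPoly (hg c) (h0 c) (hgτ c)
  choose s hs' using fun c =>
    Module.exists_dual_forall_apply_eq_one (K := k)
      (LinearIndepOn.singleton (v := id) (i := (1 : QuotAlg (g c))) one_ne_zero)
  have hs : ∀ c, s c 1 = 1 := fun c => hs' c 1 rfl
  let W := ∀ c, QuotAlg (g c)
  let Θ : W →ₐ[k] W := AlgHom.pi fun c => (θ c).comp (Pi.evalAlgHom k _ (τ c))
  have hΘ : ∀ (x : W) c, Θ x c = θ c (x (τ c)) := fun _ _ => rfl
  let S : W →ₗ[k] k := ∑ c, (s c).comp (LinearMap.proj c)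
  have hS : ∀ x : W, S x = ∑ c, s c (x c) := fun x => by
    rw [LinearMap.sum_apply]
    rfl
  have hΘΘ : ∀ x : W, Θ (Θ x) = x := by
    have aux : ∀ (x : W) (c d : T) (_ : d = c) (h : QuotAlg (g d) →ₐ[k] QuotAlg (g c)),
        h (quotX (g d)) = quotX (g c) → h (x d) = x c := by
      rintro x c _ rfl h hh
      have : h = AlgHom.id k _ := QuotAlg.algHom_ext hh
      rw [this, AlgHom.id_apply]
    intro x
    funext c
    refine aux x c _ (hτ c) ((θ c).comp (θ (τ c))) ?_
    have h1 := congrArg (θ c) (hθ (τ c))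
    rw [map_mul, map_one] at h1
    have h2 := hθ c
    have h3 : θ c (quotX (g (τ c))) ≠ 0 := left_ne_zero_of_mul_eq_one h2
    rw [AlgHom.comp_apply]
    apply mul_right_cancel₀ h3
    rw [h1, mul_comm, h2]
  let F : W →ₗ[k] k := S + S.comp Θ.toLinearMap
  have hF : ∀ x, F x = S x + S (Θ x) := fun _ => rfl
  let B : LinearMap.BilinForm k W := ((LinearMap.mul k W).compl₂ Θ.toLinearMap).compr₂ F
  have hB : ∀ x y, B x y = F (x * Θ y) := fun _ _ => rfl
  let E : T → W := fun c d => if d = c then 1 else 0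
  have hE : ∀ c d, E c d = if d = c then 1 else 0 := fun _ _ => rfl
  have hΘE : ∀ c, Θ (E c) = E (τ c) := by
    intro c
    funext d
    have hiff : τ d = c ↔ d = τ c := ⟨fun h => h ▸ (hτ d).symm, fun h => h ▸ hτ c⟩
    rw [hΘ, hE, hE, apply_ite (θ d), map_one, map_zero]
    exact if_congr hiff rfl rfl
  have hSE : ∀ c, S (E c) = 1 := by
    intro c
    rw [hS, Finset.sum_eq_single c, hE, if_pos rfl, hs]
    · intro d _ hd
      rw [hE, if_neg hd, map_zero]
    · simp
  have hFE : ∀ c, F (E c) ≠ 0 := by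
    intro c
    rwa [hF, hΘE, hSE, hSE, one_add_one_eq_two]
  have hsingle : ∀ c, Pi.single c 1 = E c := by
    intro c
    funext d
    by_cases h : d = c
    · subst h
      rw [Pi.single_eq_same, hE, if_pos rfl]
    · rw [Pi.single_eq_of_ne h, hE, if_neg h]
  refine ⟨B, ⟨fun x y => ?_, fun x hx => ?_⟩, fun x y => ?_, fun c hc => ?_⟩
  · rw [hB, hB, hF, hF, map_mul Θ, map_mul Θ, hΘΘ, hΘΘ, add_comm, mul_comm y, mul_comm (Θ y)]
  · by_contra hne
    obtain ⟨c, hc⟩ := Function.ne_iff.mp hne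
    have h1 := hx (Θ fun d => if d = c then (x d)⁻¹ else 0)
    rw [hB, hΘΘ] at h1
    refine hFE c ?_
    convert h1 using 2
    funext d
    by_cases h : d = c
    · subst h
      change E d d = x d * (if d = d then (x d)⁻¹ else 0)
      rw [hE, if_pos rfl, if_pos rfl]
      exact (mul_inv_cancel₀ hc).symm
    · change E c d = x d * (if d = c then (x d)⁻¹ else 0)
      rw [hE, if_neg h, if_neg h, mul_zero]
  · rw [hB, hB]
    congr 1
    funext c
    change quotX (g c) * x c * θ c (quotX (g (τ c)) * y (τ c)) = x c * θ c (y (τ c))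
    rw [map_mul]
    linear_combination (x c * θ c (y (τ c))) * hθ c
  · rw [hB, hsingle, hΘE, hc]
    have : E c * E c = E c := by
      funext d
      change E c d * E c d = E c d
      rw [hE]
      split_ifs <;> simp
    rw [this]
    exact hFE c

theorem exists_rescaled_form {V : Type} [AddCommGroup V] [Module k V] [FiniteDimensional k V]
    {B : LinearMap.BilinForm k V} (hB : IsQuadraticSpace B) {t : Module.End k V}
    (ht : ∀ x y, B (t x) (t y) = B x y) {v : V} (hv : B v v ≠ 0) {ε : k} (hε : ε * ε = 1)
    (htv : t v = ε • v) {d : k} (hd : d ≠ 0) :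
    ∃ B' : LinearMap.BilinForm k V, IsQuadraticSpace B' ∧ (∀ x y, B' (t x) (t y) = B' x y) ∧
      ∀ {ι : Type} [Fintype ι] [DecidableEq ι] (b : Module.Basis ι k V),
        (LinearMap.toMatrix₂ b b B').det = d * (LinearMap.toMatrix₂ b b B).det := by
  obtain ⟨hsymm, hnd⟩ := hB
  let f : Module.Dual k V := ((d - 1) / B v v) • B v
  have hf : ∀ x, f x = (d - 1) / B v v * B v x := fun _ => rfl
  have hfv : 1 + f v = d := by rw [hf, div_mul_cancel₀ _ hv, add_sub_cancel]
  let S := LinearMap.transvection f v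
  have hS : ∀ x, S x = x + f x • v := fun _ => rfl
  have hB' : ∀ x y, (B ∘ₗ S) x y = B x y + (d - 1) / B v v * B v x * B v y := fun x y => by
    rw [LinearMap.comp_apply, hS, map_add, map_smul, LinearMap.add_apply, LinearMap.smul_apply,
      smul_eq_mul, hf]
  have htB : ∀ x, B v x = ε * B v (t x) := fun x => by
    rw [← ht v x, htv, map_smul, LinearMap.smul_apply, smul_eq_mul]
  refine ⟨B ∘ₗ S, ⟨fun x y => ?_, fun x hx => ?_⟩, fun x y => ?_, fun b => ?_⟩
  · rw [hB', hB', hsymm x y]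
    ring
  · have hx0 : S x = 0 := hnd _ hx
    rw [hS] at hx0
    have h1 : f x * d = 0 := by
      have h := congrArg f hx0
      rw [map_add, map_smul, smul_eq_mul, map_zero] at h
      rw [← hfv]
      linear_combination h
    rw [(mul_eq_zero_iff_right hd).mp h1, zero_smul, add_zero] at hx0
    exact hx0
  · rw [hB', hB', ht, htB x, htB y]
    linear_combination (-(d - 1) / B v v * B v (t x) * B v (t y)) * hε
  · rw [LinearMap.toMatrix₂_comp b b, Matrix.det_mul, Matrix.det_transpose,
      LinearMap.det_toMatrix, LinearMap.transvection.det, hfv]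

theorem IsQuadraticSpace.det_toMatrix₂_ne_zero {V : Type} [AddCommGroup V] [Module k V]
    {B : LinearMap.BilinForm k V} (hB : IsQuadraticSpace B) {ι : Type} [Fintype ι]
    [DecidableEq ι] (b : Module.Basis ι k V) : (LinearMap.toMatrix₂ b b B).det ≠ 0 :=
  (LinearMap.separatingLeft_iff_det_ne_zero b).mp hB.2

theorem IsQuadraticSpace.isSymm_toMatrix₂ {V : Type} [AddCommGroup V] [Module k V]
    {B : LinearMap.BilinForm k V} (hB : IsQuadraticSpace B) {ι : Type} [Fintype ι]
    [DecidableEq ι] (b : Module.Basis ι k V) : (LinearMap.toMatrix₂ b b B).IsSymm :=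
  Matrix.ext fun i j => by
    rw [Matrix.transpose_apply, LinearMap.toMatrix₂_apply, LinearMap.toMatrix₂_apply, hB.1]

theorem exists_linearEquiv_of_toMatrix₂_eq {V W : Type} [AddCommGroup V] [Module k V]
    [AddCommGroup W] [Module k W] {B : LinearMap.BilinForm k V} {B' : LinearMap.BilinForm k W}
    {ι : Type} [Fintype ι] [DecidableEq ι] (b : Module.Basis ι k V) (b' : Module.Basis ι k W)
    {P : Matrix ι ι k} (hP : P.det ≠ 0)
    (h : LinearMap.toMatrix₂ b b B = P.transpose * LinearMap.toMatrix₂ b' b' B' * P) :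
    ∃ ψ : V ≃ₗ[k] W, ∀ x y, B' (ψ x) (ψ y) = B x y := by
  let ψ : V ≃ₗ[k] W := (Matrix.toLinearEquiv b P hP.isUnit).trans (b.equiv b' (Equiv.refl ι))
  have hψ : LinearMap.toMatrix b b' ψ.toLinearMap = P := by
    have : ψ.toLinearMap = Matrix.toLin b b' P := b.ext fun i => by
      simp [ψ, Matrix.toLin_self]
    rw [this, LinearMap.toMatrix_toLin]
  have key : B'.compl₁₂ ψ.toLinearMap ψ.toLinearMap = B := by
    apply (LinearMap.toMatrix₂ b b).injective
    rw [LinearMap.toMatrix₂_compl₁₂ b' b', hψ, h]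
  exact ⟨ψ, fun x y => by rw [← key]; rfl⟩

theorem eq_X_sub_C_of_irreducible_of_eval_eq_zero {p : k[X]} (hm : p.Monic)
    (hp : Irreducible p) {x : k} (h : p.eval x = 0) : p = X - C x := by
  refine eq_of_monic_of_associated hm (monic_X_sub_C x) ?_
  exact ((irreducible_X_sub_C x).associated_of_dvd hp (dvd_iff_isRoot.mpr h)).symm

theorem eval_starPoly_eq_zero {p : k[X]} {ε : k} (hε : ε * ε = 1) (h : p.eval ε = 0) :
    (starPoly p).eval ε = 0 := by
  let _ : Invertible ε := ⟨ε, hε, hε⟩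
  have : eval₂ (RingHom.id k) (⅟ε) p.reverse = 0 := by
    rwa [eval₂_reverse_eq_zero_iff]
  rw [starPoly, eval_mul]
  exact mul_eq_zero_of_right _ this

namespace ModuleData

variable (D : ModuleData k)

/-- The indices of the cyclic summands of `M`. -/
abbrev Summand : Type := Σ i, Fin (D.n i)

/-- The polynomial whose ideal defines a cyclic summand of `M`. -/
abbrev summandPoly (c : D.Summand) : k[X] := ((D.f c.1).map (RingHom.id k)) ^ D.e c.1

variable {D}

theorem Semisimple.summandPoly_eq (hss : D.Semisimple) (c : D.Summand) :
    D.summandPoly c = D.f c.1 := by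
  rw [summandPoly, Polynomial.map_id, hss, pow_one]

theorem Semisimple.prod_eval_summandPoly (hss : D.Semisimple) (x : k) :
    ∏ c, (D.summandPoly c).eval x = D.charPoly.eval x := by
  rw [charPoly, eval_prod, Fintype.prod_sigma]
  refine Finset.prod_congr rfl fun i _ => ?_
  simp [hss.summandPoly_eq, hss i]

theorem Semisimple.finrank_pi_summandPoly (hss : D.Semisimple) :
    Module.finrank k (∀ c, QuotAlg (D.summandPoly c)) = D.dim := by
  have hm : ∀ c, (D.summandPoly c).Monic := fun c => by
    rw [hss.summandPoly_eq]
    exact D.monic _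
  have := fun c => QuotAlg.finite (hm c)
  rw [Module.finrank_pi_fintype, dim, Fintype.sum_sigma]
  refine Finset.sum_congr rfl fun i _ => ?_
  simp only [QuotAlg.finrank (hm _), hss.summandPoly_eq]
  simp [hss i]

variable (D)

/-- `M` as the product of its cyclic summands. -/
def piEquivSpaceVia : (∀ c, QuotAlg (D.summandPoly c)) ≃ₗ[k] D.SpaceVia (RingHom.id k) :=
  LinearEquiv.piCurry k fun i (a : Fin (D.n i)) => QuotAlg (D.summandPoly ⟨i, a⟩)

theorem piEquivSpaceVia_piMulX (x : ∀ c, QuotAlg (D.summandPoly c)) :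
    D.piEquivSpaceVia (piMulX _ x) = (X : k[X]) • D.piEquivSpaceVia x := by
  funext i a
  exact (Algebra.smul_def (X : k[X]) (x ⟨i, a⟩)).symm

end ModuleData

theorem hasIsometryWithModule_iff_exists_piMulX {V : Type} [AddCommGroup V] [Module k V]
    {B : LinearMap.BilinForm k V} {D : ModuleData k} :
    HasIsometryWithModule B D ↔ ∃ t : V ≃ₗ[k] V, IsIsometryOf B t ∧
      ∃ ψ : V ≃ₗ[k] (∀ c, QuotAlg (D.summandPoly c)), ∀ x, ψ (t x) = piMulX _ (ψ x) := by
  constructor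
  · rintro ⟨t, ht, φ, hφ⟩
    refine ⟨t, ht, φ.trans D.piEquivSpaceVia.symm, fun x => ?_⟩
    apply D.piEquivSpaceVia.injective
    simp [ModuleData.piEquivSpaceVia_piMulX, hφ]
  · rintro ⟨t, ht, ψ, hψ⟩
    refine ⟨t, ht, ψ.trans D.piEquivSpaceVia, fun x => ?_⟩
    simp [← ModuleData.piEquivSpaceVia_piMulX, hψ]

theorem ModuleData.Semisimple.exists_form (h2 : (2 : k) ≠ 0) {D : ModuleData k}
    (hss : D.Semisimple) {ι : Type} [Fintype ι] [DecidableEq ι]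
    (b : Module.Basis ι k (∀ c, QuotAlg (D.summandPoly c))) {δ : k} (hδ : δ ≠ 0)
    (h : IsSquare (δ * (D.charPoly.eval 1 * D.charPoly.eval (-1)))) :
    ∃ B : LinearMap.BilinForm k (∀ c, QuotAlg (D.summandPoly c)), IsQuadraticSpace B ∧
      (∀ x y, B (piMulX _ x) (piMulX _ y) = B x y) ∧
      IsSquare ((LinearMap.toMatrix₂ b b B).det * δ) := by
  classical
  have : FiniteDimensional k (∀ c, QuotAlg (D.summandPoly c)) := b.finiteDimensional_of_finite
  have hm : ∀ c, (D.summandPoly c).Monic := fun c => by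
    rw [hss.summandPoly_eq]
    exact D.monic _
  have hirr : ∀ c, Irreducible (D.summandPoly c) := fun c => by
    rw [hss.summandPoly_eq]
    exact D.irr _
  obtain ⟨σ, hσ⟩ := D.selfdual
  let σ' : Equiv.Perm D.Summand := Equiv.sigmaCongr σ fun i => finCongr (hσ i).2.2.symm
  have hσ' : ∀ c, D.summandPoly (σ' c) = starPoly (D.summandPoly c) := fun c => by
    rw [hss.summandPoly_eq, hss.summandPoly_eq]
    exact (hσ c.1).1
  have h0 : ∀ c, (D.summandPoly c).coeff 0 ≠ 0 := fun c =>
    coeff_zero_ne_zero_of_starPoly_monic (hσ' c ▸ hm _)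
  obtain ⟨τ, hτ, hgτ, hfix⟩ := Equiv.Perm.exists_involution_of_comp_eq D.summandPoly starPoly
    (fun c => starPoly_starPoly (hm c) (h0 c)) σ' hσ'
  obtain ⟨B, hB, hinv, hv⟩ := exists_invariant_form h2 hirr h0 hτ hgτ
  by_cases hF : D.charPoly.eval 1 * D.charPoly.eval (-1) = 0
  · obtain ⟨c, ε, hε, hc⟩ : ∃ c, ∃ ε : k, ε * ε = 1 ∧ (D.summandPoly c).eval ε = 0 := by
      rw [← hss.prod_eval_summandPoly, ← hss.prod_eval_summandPoly] at hF
      rcases mul_eq_zero.mp hF with hF | hF <;>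
        obtain ⟨c, -, hc⟩ := Finset.prod_eq_zero_iff.mp hF
      · exact ⟨c, 1, by ring, hc⟩
      · exact ⟨c, -1, by ring, hc⟩
    have hX := eq_X_sub_C_of_irreducible_of_eval_eq_zero (hm c) (hirr c) hc
    have hτc : τ c = c := hfix c <| by
      rw [← hgτ, eq_X_sub_C_of_irreducible_of_eval_eq_zero (hm (τ c)) (hirr (τ c)), ← hX]
      rw [hgτ]
      exact eval_starPoly_eq_zero hε hc
    have heig : piMulX D.summandPoly (Pi.single c 1) = ε • Pi.single c 1 := by
      funext d
      rw [piMulX_apply, Pi.smul_apply]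
      by_cases hd : d = c
      · subst hd
        have hε1 : ε • (1 : QuotAlg (D.summandPoly d)) = Ideal.Quotient.mk _ (C ε) :=
          (Algebra.algebraMap_eq_smul_one ε).symm
        rw [Pi.single_eq_same, mul_one, hε1]
        exact Ideal.Quotient.eq.mpr (Ideal.mem_span_singleton.mpr hX.dvd)
      · rw [Pi.single_eq_of_ne hd, mul_zero, smul_zero]
    obtain ⟨B', hB', hinv', hdet⟩ := exists_rescaled_form hB hinv (hv c hτc) hε heig
      (mul_ne_zero hδ (hB.det_toMatrix₂_ne_zero b))
    refine ⟨B', hB', hinv', δ * (LinearMap.toMatrix₂ b b B).det, ?_⟩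
    rw [hdet]
    ring
  · have hinj : Function.Injective (piMulX D.summandPoly) := by
      refine (injective_iff_map_eq_zero _).mpr fun x hx => hB.2 x fun y => ?_
      rw [← hinv, hx, map_zero, LinearMap.zero_apply]
    let t := LinearEquiv.ofInjectiveEndo _ hinj
    have ht : IsIsometryOf B t := hinv
    have hsq := ht.isSquare_det_mul h2 hB.1 b
    have htX : t.toLinearMap = piMulX D.summandPoly := rfl
    rw [htX, det_algebraMap_sub_piMulX hm, det_algebraMap_sub_piMulX hm,
      hss.prod_eval_summandPoly, hss.prod_eval_summandPoly] at hsq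
    refine ⟨B, hB, hinv, ?_⟩
    have := (hsq.mul h).div (IsSquare.mul_self (D.charPoly.eval 1 * D.charPoly.eval (-1)))
    rwa [mul_mul_mul_comm, mul_div_cancel_right₀ _ (mul_ne_zero hF hF)] at this

end Helpers

/-- **Prop. 6.1.** Suppose `I(k)² = 0`, i.e. any two quadratic spaces over
`k` of the same dimension and the same determinant in `k*/k*²` are isometric. Then a
quadratic space `q` with `dim q = dim_k M` has an isometry with the semi-simple module
`M` iff `det(q)·F_M(1)·F_M(−1)` is a square in `k`. -/
theorem hasIsometryWithModule_iff_isSquare_of_I2_eq_zero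
    (hchar : (2 : k) ≠ 0)
    (hI2 : ∀ (n : ℕ) (M N : Matrix (Fin n) (Fin n) k), M.IsSymm → N.IsSymm →
      M.det ≠ 0 → N.det ≠ 0 → IsSquare (M.det * N.det) →
      ∃ P : Matrix (Fin n) (Fin n) k, P.det ≠ 0 ∧ N = P.transpose * M * P)
    (D : ModuleData k) (hss : D.Semisimple)
    {V : Type} [AddCommGroup V] [Module k V] [FiniteDimensional k V]
    (B : LinearMap.BilinForm k V) (hq : IsQuadraticSpace B)
    (hdim : Module.finrank k V = D.dim) :
    HasIsometryWithModule B D ↔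
      IsSquare (detOf B * (D.charPoly.eval 1 * D.charPoly.eval (-1))) := by
  have hB0 : detOf B ≠ 0 := hq.det_toMatrix₂_ne_zero _
  have hm : ∀ c, (D.summandPoly c).Monic := fun c => by
    rw [hss.summandPoly_eq]
    exact D.monic _
  constructor
  · intro h
    obtain ⟨t, ht, ψ, hψ⟩ := hasIsometryWithModule_iff_exists_piMulX.mp h
    have hdet : ∀ a : k, LinearMap.det (algebraMap k (Module.End k V) a - t.toLinearMap) =
        D.charPoly.eval a := fun a => by
      rw [← hss.prod_eval_summandPoly, ← det_algebraMap_sub_piMulX hm, ← LinearMap.det_conj _ ψ]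
      congr 1
      refine LinearMap.ext fun x => ?_
      simp [hψ, map_sub]
    have := ht.isSquare_det_mul hchar hq.1 (Module.finBasis k V)
    rwa [hdet, hdet] at this
  · intro h
    have hfin := hss.finrank_pi_summandPoly.trans hdim.symm
    have := fun c => QuotAlg.finite (hm c)
    let b := Module.finBasisOfFinrankEq k _ hfin
    obtain ⟨B', hB', hinv, hsq⟩ := hss.exists_form hchar b hB0 h
    obtain ⟨P, hP, hPB⟩ := hI2 _ _ (gramOf B) (hB'.isSymm_toMatrix₂ b) (hq.isSymm_toMatrix₂ _)
      (hB'.det_toMatrix₂_ne_zero b) hB0 hsq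
    obtain ⟨ψ, hψ⟩ := exists_linearEquiv_of_toMatrix₂_eq _ b hP hPB
    have hinj : Function.Injective (piMulX D.summandPoly) := by
      refine (injective_iff_map_eq_zero _).mpr fun x hx => hB'.2 x fun y => ?_
      rw [← hinv, hx, map_zero, LinearMap.zero_apply]
    refine hasIsometryWithModule_iff_exists_piMulX.mpr
      ⟨(ψ.trans (LinearEquiv.ofInjectiveEndo _ hinj)).trans ψ.symm, fun x y => ?_, ψ, fun x => ?_⟩
    · rw [← hψ, ← hψ x y, ← hinv (ψ x)]
      simp
    · simp

end
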